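/- Let 𝒯=(V,ℰ) be a leafless, locally finite rooted directed tree, q ≥ 1 a real number, and S_{λ,q} the Dirichlet shift on ℓ²(V). Then ℓ²(V) equals the closed linear span of the set {S_{λ,q}^n f : n ∈ ℕ, f ∈ ker S_{λ,q}*}. -/

import Mathlib

open scoped ENNReal InnerProductSpace
open ContinuousLinearMap

noncomputable section

/-- A (countably infinite) rooted directed tree. -/
structure DirTree (V : Type) where
  edge : V → V → Prop
  not_self : ∀ v, ¬ edge v v
  no_circuit : ∀ v, ¬ Relation.TransGen edge v v
  connected : ∀ u v : V, Relation.ReflTransGen (fun a b => edge a b ∨ edge b a) u v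
  uniq_parent : ∀ {u w v : V}, edge u v → edge w v → u = w
  root : V
  root_no_parent : ∀ u, ¬ edge u root
  root_uniq : ∀ v, (∀ u, ¬ edge u v) → v = root

namespace DirTree

variable {V : Type} (T : DirTree V)

/-- The set of children of a vertex. -/
def chi (v : V) : Set V := {u | T.edge v u}

/-- Leafless: every vertex has a child. -/
def Leafless : Prop := ∀ v : V, ∃ u, T.edge v u

/-- Locally finite: every vertex has finitely many children. -/
def LocFin : Prop := ∀ v : V, (T.chi v).Finite

/-- The finset of children of a vertex (locally finite case). -/
def chiFin (hT : T.LocFin) (v : V) : Finset V := (hT v).toFinset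

/-- Iterated child sets `Chi^⟨n⟩(W)`. -/
def chiIter (T : DirTree V) : ℕ → Set V → Set V
  | 0, W => W
  | n + 1, W => {u | ∃ v ∈ chiIter T n W, T.edge v u}

/-- The depth of a vertex: the unique `n` with `v ∈ Chi^⟨n⟩(root)`. -/
def depth (v : V) : ℕ := sInf {n | v ∈ T.chiIter n {T.root}}

/-- The parent map (junk value at the root). -/
def par (v : V) : V :=
  letI := Classical.propDecidable (∃ u, T.edge u v)
  if h : ∃ u, T.edge u v then h.choose else v

end DirTree

/-- `ℓ²(V)`. -/
abbrev l2 (V : Type) := lp (fun _ : V => ℂ) 2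

/-- The standard orthonormal basis vector `e_v` of `ℓ²(V)`. -/
def evec {V : Type} (v : V) : l2 V :=
  letI := Classical.decEq V
  lp.single 2 v 1

/-- The Pochhammer symbol `(x)_k = x (x+1) ⋯ (x+k-1)`. -/
def poch (x : ℝ) (k : ℕ) : ℝ := ∏ i ∈ Finset.range k, (x + i)

namespace DirTree

variable {V : Type} (T : DirTree V)

/-- The weight `λ_{u,q}` (for any child `u` of `v`). -/
def wt (hT : T.LocFin) (q : ℝ) (v : V) : ℝ :=
  Real.sqrt (((T.depth v : ℝ) + q) / ((T.depth v : ℝ) + 1)) /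
    Real.sqrt ((T.chiFin hT v).card)

/-- `S` is the Dirichlet shift with parameter `q` on `ℓ²(V)`:
`S e_v = ∑_{u ∈ Chi(v)} λ_{u,q} e_u`. -/
def IsDirichletShift (hT : T.LocFin) (q : ℝ) (S : l2 V →L[ℂ] l2 V) : Prop :=
  ∀ v : V, S (evec v) = ∑ u ∈ T.chiFin hT v, ((T.wt hT q v : ℝ) : ℂ) • evec u

end DirTree

/-- The Cauchy dual `S (S*S)⁻¹` of a left-invertible operator. -/
def cauchyDual {V : Type} (S : l2 V →L[ℂ] l2 V) : l2 V →L[ℂ] l2 V :=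
  S * Ring.inverse (ContinuousLinearMap.adjoint S * S)

theorem inner_evec_left {V : Type} (v : V) (f : l2 V) : ⟪evec v, f⟫_ℂ = f v := by
  classical
  unfold evec
  rw [lp.inner_single_left]
  simp

open Classical in
theorem evec_apply {V : Type} (v w : V) :
    (evec v : l2 V) w = if w = v then 1 else 0 := by
  unfold evec
  rw [lp.single_apply, Pi.single_apply]

namespace DirTree

variable {V : Type} (T : DirTree V)

theorem mem_chiFin (hT : T.LocFin) {v u : V} : u ∈ T.chiFin hT v ↔ T.edge v u := by
  simp [chiFin, chi]

theorem reflTransGen_root (v : V) : Relation.ReflTransGen T.edge T.root v := by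
  induction T.connected T.root v with
  | refl => exact .refl
  | tail _ h ih =>
    rcases h with h | h
    · exact ih.tail h
    · rcases ih.cases_tail with rfl | ⟨p, hp, hpb⟩
      · exact (T.root_no_parent _ h).elim
      · rwa [← T.uniq_parent hpb h]

theorem wt_pos (hL : T.Leafless) (hT : T.LocFin) {q : ℝ} (hq : 1 ≤ q) (v : V) :
    0 < T.wt hT q v := by
  obtain ⟨u, hu⟩ := hL v
  have hcard : 0 < (T.chiFin hT v).card := Finset.card_pos.mpr ⟨u, (T.mem_chiFin hT).mpr hu⟩
  unfold wt
  positivity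

variable {T}

theorem IsDirichletShift.adjoint_apply {hT : T.LocFin} {q : ℝ} {S : l2 V →L[ℂ] l2 V}
    (hS : T.IsDirichletShift hT q S) (f : l2 V) (v : V) :
    adjoint S f v = T.wt hT q v * ∑ u ∈ T.chiFin hT v, f u := by
  rw [← inner_evec_left, adjoint_inner_right, hS v, sum_inner, Finset.mul_sum]
  simp only [inner_smul_left, inner_evec_left, Complex.conj_ofReal]

/-- The difference between `e_u` and the mean of `e_w` over the siblings `w` of `u` is
annihilated by the adjoint of a Dirichlet shift. -/
theorem IsDirichletShift.adjoint_evec_sub_mean {hT : T.LocFin} {q : ℝ} {S : l2 V →L[ℂ] l2 V}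
    (hS : T.IsDirichletShift hT q S) {v u : V} (huv : T.edge v u) :
    adjoint S (evec u - ((T.chiFin hT v).card : ℂ)⁻¹ • ∑ w ∈ T.chiFin hT v, evec w) = 0 := by
  classical
  have hcard : ((T.chiFin hT v).card : ℂ) ≠ 0 :=
    Nat.cast_ne_zero.mpr (Finset.card_ne_zero_of_mem ((T.mem_chiFin hT).mpr huv))
  have hsum (x : V) : (∑ w ∈ T.chiFin hT v, evec w : l2 V) x =
      if T.edge v x then 1 else 0 := by
    rw [lp.coeFn_sum, Finset.sum_apply]
    simp [evec_apply, mem_chiFin]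
  ext z
  rw [hS.adjoint_apply]
  simp only [lp.coeFn_sub, lp.coeFn_smul, Pi.sub_apply, Pi.smul_apply, hsum, evec_apply,
    Finset.sum_sub_distrib, smul_eq_mul, ← Finset.mul_sum, Finset.sum_ite_eq', mem_chiFin,
    lp.coeFn_zero, Pi.zero_apply]
  by_cases hz : z = v
  · subst hz
    rw [Finset.sum_congr rfl fun x hx => if_pos ((T.mem_chiFin hT).mp hx)]
    simp [huv, hcard]
  · rw [Finset.sum_eq_zero fun x hx =>
      if_neg fun h => hz (T.uniq_parent ((T.mem_chiFin hT).mp hx) h)]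
    simp [show ¬ T.edge z u from fun h => hz (T.uniq_parent h huv)]

theorem IsDirichletShift.adjoint_evec_root {hT : T.LocFin} {q : ℝ} {S : l2 V →L[ℂ] l2 V}
    (hS : T.IsDirichletShift hT q S) : adjoint S (evec T.root) = 0 := by
  classical
  ext z
  rw [hS.adjoint_apply]
  simp [evec_apply, mem_chiFin, T.root_no_parent]

/-- A subspace that contains the kernel of `S*` and is invariant under the Dirichlet shift `S`
contains every basis vector. -/
theorem IsDirichletShift.evec_mem {hT : T.LocFin} {q : ℝ} {S : l2 V →L[ℂ] l2 V}
    (hS : T.IsDirichletShift hT q S) (hL : T.Leafless) (hq : 1 ≤ q)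
    {M : Submodule ℂ (l2 V)} (hker : ∀ f, adjoint S f = 0 → f ∈ M)
    (hinv : ∀ f ∈ M, S f ∈ M) (v : V) : evec v ∈ M := by
  induction T.reflTransGen_root v with
  | refl => exact hker _ hS.adjoint_evec_root
  | @tail b c _ hbc ih =>
    have hwt : (T.wt hT q b : ℂ) ≠ 0 := Complex.ofReal_ne_zero.mpr (T.wt_pos hL hT hq b).ne'
    have hsum : ∑ w ∈ T.chiFin hT b, evec w ∈ M := by
      have h := hinv _ ih
      rw [hS b, ← Finset.smul_sum] at h
      exact (M.smul_mem_iff hwt).mp h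
    have h := M.add_mem (hker _ (hS.adjoint_evec_sub_mean hbc))
      (M.smul_mem ((T.chiFin hT b).card : ℂ)⁻¹ hsum)
    rwa [sub_add_cancel] at h

end DirTree

theorem stmt_7 {V : Type} [Countable V] [Infinite V] (T : DirTree V)
    (hL : T.Leafless) (hT : T.LocFin) (q : ℝ) (hq : 1 ≤ q)
    (S : l2 V →L[ℂ] l2 V) (hS : T.IsDirichletShift hT q S) :
    (Submodule.span ℂ {g : l2 V | ∃ (n : ℕ) (f : l2 V),
        ContinuousLinearMap.adjoint S f = 0 ∧ g = (S ^ n) f}).topologicalClosure = ⊤ := by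
  rw [Submodule.topologicalClosure_eq_top_iff, Submodule.eq_bot_iff]
  intro g hg
  ext v
  rw [← inner_evec_left]
  refine Submodule.inner_right_of_mem_orthogonal (hS.evec_mem hL hq ?_ ?_ v) hg
  · exact fun f hf => Submodule.subset_span ⟨0, f, hf, by simp⟩
  · intro f hf
    induction hf using Submodule.span_induction with
    | mem x hx =>
      obtain ⟨n, f, hf, rfl⟩ := hx
      exact Submodule.subset_span ⟨n + 1, f, hf, by rw [pow_succ']; rfl⟩
    | zero => simp
    | add x y _ _ hx hy => simpa using Submodule.add_mem _ hx hy
    | smul a x _ hx => simpa using Submodule.smul_mem _ a hx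

end
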